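/- Assume the jump-free theorem. Let Θ = {(x,y) ∈ N^k × N^k : max(x) > max(y)} be the maximal downward edge set, let G = (N^k, Θ), fix any family ℱ_G of partial selection functions, and let p be a positive integer. Then there exist a finite set D ⊆ N^k and a set E ⊆ N with |E| = p and E^k ⊆ D such that the selection labeling function s_D is regressively regular over E^k; in particular, the set of s_D-significant labels {s_D(z) : z ∈ E^k, s_D(z) < min(z)} has cardinality at most k^k. -/

import Mathlib

namespace LatticeMultiverse

/-- Maximum coordinate value of a lattice point `x ∈ ℕ^k`. -/
noncomputable def vmax {k : ℕ} (x : Fin k → ℕ) : ℕ := sSup (Set.range x)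

/-- Minimum coordinate value of a lattice point `x ∈ ℕ^k`. -/
noncomputable def vmin {k : ℕ} (x : Fin k → ℕ) : ℕ := sInf (Set.range x)

/-- `G = (ℕ^k, Θ)` is a downward directed lattice graph:
every edge `(x, y) ∈ Θ` satisfies `max x > max y`. -/
def Downward {k : ℕ} (Θ : Set ((Fin k → ℕ) × (Fin k → ℕ))) : Prop :=
  ∀ e ∈ Θ, vmax e.2 < vmax e.1

/-- A path in the induced subgraph `G_D`: a nonempty list of distinct vertices of `D`
with consecutive pairs being edges of `Θ` (hence of `Θ_D`). -/
def IsPath {k : ℕ} (Θ : Set ((Fin k → ℕ) × (Fin k → ℕ))) (D : Finset (Fin k → ℕ))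
    (l : List (Fin k → ℕ)) : Prop :=
  l ≠ [] ∧ l.Nodup ∧ (∀ x ∈ l, x ∈ D) ∧ l.Chain' (fun a b => (a, b) ∈ Θ)

/-- A terminal path in `G_D`: a path admitting no one-vertex extension. -/
def IsTerminalPath {k : ℕ} (Θ : Set ((Fin k → ℕ) × (Fin k → ℕ))) (D : Finset (Fin k → ℕ))
    (l : List (Fin k → ℕ)) : Prop :=
  IsPath Θ D l ∧ ∀ y, ¬ IsPath Θ D (l ++ [y])

/-- `T_D(z)`: the set of last vertices of terminal paths in `G_D` starting at `z`. -/
def TD {k : ℕ} (Θ : Set ((Fin k → ℕ) × (Fin k → ℕ))) (D : Finset (Fin k → ℕ))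
    (z : Fin k → ℕ) : Set (Fin k → ℕ) :=
  {w | ∃ l, IsTerminalPath Θ D l ∧ l.head? = some z ∧ l.getLast? = some w}

/-- The terminal label function `t_D(z) = min({min x : x ∈ T_D(z)} ∪ {min z})`. -/
noncomputable def tD {k : ℕ} (Θ : Set ((Fin k → ℕ) × (Fin k → ℕ))) (D : Finset (Fin k → ℕ))
    (z : Fin k → ℕ) : ℕ :=
  sInf (vmin '' TD Θ D z ∪ {vmin z})

open Classical in
/-- The relaxed terminal label function `t̂_D`: `max z` if the one-vertex path `(z)` is
terminal in `G_D`, and `t_D z` otherwise. -/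
noncomputable def tDhat {k : ℕ} (Θ : Set ((Fin k → ℕ) × (Fin k → ℕ))) (D : Finset (Fin k → ℕ))
    (z : Fin k → ℕ) : ℕ :=
  if IsTerminalPath Θ D [z] then vmax z else tD Θ D z

/-- Two `k`-tuples have the same order type. -/
def SameOrderType {k : ℕ} (x y : Fin k → ℕ) : Prop :=
  (∀ i j, x i < x j ↔ y i < y j) ∧ (∀ i j, x i = x j ↔ y i = y j)

/-- The cube `E^k ⊆ ℕ^k`. -/
def cube (k : ℕ) (E : Finset ℕ) : Finset (Fin k → ℕ) := Fintype.piFinset fun _ => E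

/-- `f` is regressively regular over `E^k`: for each order type of `k`-tuples,
either `f x ≥ min x` for all `x ∈ E^k` of that order type, or
`f x = f y < min E` for all `x, y ∈ E^k` of that order type. -/
def RegressivelyRegular {k : ℕ} (E : Finset ℕ) (f : (Fin k → ℕ) → ℕ) : Prop :=
  ∀ x ∈ cube k E,
    (∀ y ∈ cube k E, SameOrderType x y → vmin y ≤ f y) ∨
    (∀ y ∈ cube k E, ∀ z ∈ cube k E, SameOrderType x y → SameOrderType x z →
      f y = f z ∧ f y < sInf (E : Set ℕ))

/-- The set of `f`-significant labels of `S`: `{f z : z ∈ S, f z < min z}`. -/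
def sigLabels {k : ℕ} (f : (Fin k → ℕ) → ℕ) (S : Set (Fin k → ℕ)) : Set ℕ :=
  f '' {z ∈ S | f z < vmin z}

/-- A family of functions with finite domains is encoded as a set of pairs `(D, f)`,
`D` the domain.  Full: every finite `D` is the domain of some member. -/
def FullFam {k : ℕ} (Q : Set (Finset (Fin k → ℕ) × ((Fin k → ℕ) → ℕ))) : Prop :=
  ∀ D, ∃ f, (D, f) ∈ Q

/-- Reflexive: each value `f x`, `x ∈ D`, is a coordinate of some `y ∈ D`. -/
def ReflexiveFam {k : ℕ} (Q : Set (Finset (Fin k → ℕ) × ((Fin k → ℕ) → ℕ))) : Prop :=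
  ∀ p ∈ Q, ∀ x ∈ p.1, ∃ y ∈ p.1, ∃ i, p.2 x = y i

/-- Jump-free: if `x ∈ A ∩ B`, `A_x ⊆ B_x` and `f_A = f_B` on `A_x`, then `f_A x ≥ f_B x`. -/
def JumpFreeFam {k : ℕ} (Q : Set (Finset (Fin k → ℕ) × ((Fin k → ℕ) → ℕ))) : Prop :=
  ∀ A ∈ Q, ∀ B ∈ Q, ∀ x, x ∈ A.1 → x ∈ B.1 →
    (∀ z ∈ A.1, vmax z < vmax x → z ∈ B.1) →
    (∀ y ∈ A.1, vmax y < vmax x → A.2 y = B.2 y) →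
    B.2 x ≤ A.2 x

/-- Friedman's jump-free theorem (independent of ZFC), stated as a proposition to be
assumed as a hypothesis: for every full, reflexive, jump-free family `Q` on `ℕ^k` and
every `p > 0` there are a finite `D`, an `E` with `|E| = p` and `E^k ⊆ D`, and an
`f ∈ Q` with domain `D` that is regressively regular over `E^k`. -/
def JumpFreeTheorem (k : ℕ) : Prop :=
  ∀ Q : Set (Finset (Fin k → ℕ) × ((Fin k → ℕ) → ℕ)),
    FullFam Q → ReflexiveFam Q → JumpFreeFam Q →
    ∀ p : ℕ, 0 < p →
      ∃ D E f, (D, f) ∈ Q ∧ E.card = p ∧ cube k E ⊆ D ∧ RegressivelyRegular E f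

/-- `ℱ_G = {F^x_r}` is a family of partial selection functions on the out-neighborhoods
of `G = (ℕ^k, Θ)`: `F x r` is the partial function `F^x_r : (G^x × ℕ)^r ⇀ ℕ`
(`none` = undefined); whenever defined, its value is one of the `n_i`, and its domain
consists of tuples whose first components are out-neighbors of `x`. -/
def IsSelectionFamily {k : ℕ} (Θ : Set ((Fin k → ℕ) × (Fin k → ℕ)))
    (F : (Fin k → ℕ) → (r : ℕ) → (Fin r → (Fin k → ℕ) × ℕ) → Option ℕ) : Prop :=
  ∀ x r args n, F x r args = some n → (∃ i, n = (args i).2) ∧ ∀ i, (x, (args i).1) ∈ Θ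

/-- `Φ^D_x` relative to a labeling `g`: all defined values
`F^x_r((y₁, g y₁), …, (y_r, g y_r))` with `r ≥ 1` and `y₁, …, y_r ∈ G^x_D`. -/
def Phi {k : ℕ} (Θ : Set ((Fin k → ℕ) × (Fin k → ℕ)))
    (F : (Fin k → ℕ) → (r : ℕ) → (Fin r → (Fin k → ℕ) × ℕ) → Option ℕ)
    (D : Finset (Fin k → ℕ)) (g : (Fin k → ℕ) → ℕ) (x : Fin k → ℕ) : Set ℕ :=
  {n | ∃ r, 1 ≤ r ∧ ∃ y : Fin r → (Fin k → ℕ),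
    ∃ _ : ∀ i, y i ∈ D ∧ (x, y i) ∈ Θ,
    F x r (fun i => (y i, g (y i))) = some n}

open Classical in
/-- The selection labeling function `s_D`, defined by recursion on `vmax x`:
`s_D x = min Φ^D_x` if `Φ^D_x ≠ ∅` (where `Φ^D_x = Phi Θ F D (s_D) x`), and
`s_D x = min x` otherwise. -/
noncomputable def sD {k : ℕ} (Θ : Set ((Fin k → ℕ) × (Fin k → ℕ))) (hΘ : Downward Θ)
    (F : (Fin k → ℕ) → (r : ℕ) → (Fin r → (Fin k → ℕ) × ℕ) → Option ℕ)
    (D : Finset (Fin k → ℕ)) (x : Fin k → ℕ) : ℕ :=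
  let Φ : Set ℕ := {n | ∃ r, 1 ≤ r ∧ ∃ y : Fin r → (Fin k → ℕ),
    ∃ _ : ∀ i, y i ∈ D ∧ (x, y i) ∈ Θ,
    F x r (fun i => (y i, sD Θ hΘ F D (y i))) = some n}
  if Φ.Nonempty then sInf Φ else vmin x
termination_by vmax x
decreasing_by
  have h : ∀ i, y i ∈ D ∧ (x, y i) ∈ Θ := by assumption
  exact hΘ _ (h i).2

open Classical in
/-- The relaxed selection labeling function `ŝ_D`: `s_D x` if `Φ^D_x ≠ ∅`,
and `max x` otherwise. -/
noncomputable def sDhat {k : ℕ} (Θ : Set ((Fin k → ℕ) × (Fin k → ℕ))) (hΘ : Downward Θ)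
    (F : (Fin k → ℕ) → (r : ℕ) → (Fin r → (Fin k → ℕ) × ℕ) → Option ℕ)
    (D : Finset (Fin k → ℕ)) (x : Fin k → ℕ) : ℕ :=
  if (Phi Θ F D (sD Θ hΘ F D) x).Nonempty then sD Θ hΘ F D x else vmax x

/-- The maximal downward edge set `Θ = {(x, y) : max x > max y}`. -/
def maxTheta (k : ℕ) : Set ((Fin k → ℕ) × (Fin k → ℕ)) := {e | vmax e.2 < vmax e.1}

theorem maxTheta_downward (k : ℕ) : Downward (maxTheta k) := fun _ he => he

section Coordinates

variable {k : ℕ}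

theorem le_vmax (x : Fin k → ℕ) (i : Fin k) : x i ≤ vmax x :=
  le_csSup (Set.finite_range x).bddAbove ⟨i, rfl⟩

theorem vmin_le (x : Fin k → ℕ) (i : Fin k) : vmin x ≤ x i :=
  Nat.sInf_le ⟨i, rfl⟩

theorem exists_eq_vmax [NeZero k] (x : Fin k → ℕ) : ∃ i, vmax x = x i := by
  obtain ⟨i, hi⟩ := Nat.sSup_mem (Set.range_nonempty x) (Set.finite_range x).bddAbove
  exact ⟨i, hi.symm⟩

theorem exists_eq_vmin [NeZero k] (x : Fin k → ℕ) : ∃ i, vmin x = x i := by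
  obtain ⟨i, hi⟩ := Nat.sInf_mem (Set.range_nonempty x)
  exact ⟨i, hi.symm⟩

theorem vmin_le_vmax [NeZero k] (x : Fin k → ℕ) : vmin x ≤ vmax x :=
  (vmin_le x 0).trans (le_vmax x 0)

end Coordinates

section OrderType

variable {k : ℕ}

/-- The number of coordinates of `x` lying strictly below each coordinate of `x`. -/
def rankVector (x : Fin k → ℕ) (i : Fin k) : Fin k :=
  ⟨(Finset.univ.filter fun j => x j < x i).card, by
    have h : (Finset.univ.filter fun j => x j < x i) ⊂ Finset.univ :=
      Finset.filter_ssubset.2 ⟨i, Finset.mem_univ i, lt_irrefl _⟩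
    simpa using Finset.card_lt_card h⟩

theorem rankVector_lt_iff (x : Fin k → ℕ) (i j : Fin k) :
    rankVector x i < rankVector x j ↔ x i < x j := by
  simp only [rankVector, Fin.mk_lt_mk]
  constructor
  · intro h
    by_contra! hle
    refine h.not_ge (Finset.card_le_card fun l hl => ?_)
    simp only [Finset.mem_filter, Finset.mem_univ, true_and] at hl ⊢
    exact hl.trans_le hle
  · intro h
    refine Finset.card_lt_card (Finset.ssubset_iff_of_subset (fun l hl => ?_) |>.2 ⟨i, ?_, ?_⟩)
    · simp only [Finset.mem_filter, Finset.mem_univ, true_and] at hl ⊢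
      exact hl.trans h
    · simpa using h
    · simp

theorem sameOrderType_of_rankVector_eq {x y : Fin k → ℕ} (h : rankVector x = rankVector y) :
    SameOrderType x y := by
  have hlt : ∀ i j, x i < x j ↔ y i < y j := fun i j => by
    rw [← rankVector_lt_iff, h, rankVector_lt_iff]
  refine ⟨hlt, fun i j => ?_⟩
  have h₁ := hlt i j
  have h₂ := hlt j i
  omega

theorem SameOrderType.refl (x : Fin k → ℕ) : SameOrderType x x :=
  ⟨fun _ _ => Iff.rfl, fun _ _ => Iff.rfl⟩

/-- A regressively regular function has at most one significant label per order type. -/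
theorem RegressivelyRegular.ncard_sigLabels_le {E : Finset ℕ} {f : (Fin k → ℕ) → ℕ}
    (h : RegressivelyRegular E f) :
    (sigLabels f (cube k E : Set (Fin k → ℕ))).ncard ≤ k ^ k := by
  set T : Set (Fin k → ℕ) := {z ∈ (cube k E : Set (Fin k → ℕ)) | f z < vmin z} with hT
  have hsub : sigLabels f (cube k E : Set (Fin k → ℕ)) ⊆
      (fun ρ => f (Function.invFunOn rankVector T ρ)) '' Set.univ := by
    rintro _ ⟨z, hz, rfl⟩
    have hex : ∃ a ∈ T, rankVector a = rankVector z := ⟨z, hz, rfl⟩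
    refine ⟨rankVector z, Set.mem_univ _, ?_⟩
    have hmem := Function.invFunOn_mem hex
    have heq := sameOrderType_of_rankVector_eq (Function.invFunOn_eq hex).symm
    rcases h z hz.1 with hge | hconst
    · exact absurd (hge z hz.1 (.refl z)) hz.2.not_ge
    · exact (hconst _ hmem.1 z hz.1 heq (.refl z)).1
  calc _ ≤ _ := Set.ncard_le_ncard hsub (Set.toFinite _)
    _ ≤ (Set.univ : Set (Fin k → Fin k)).ncard := Set.ncard_image_le
    _ = k ^ k := by simp [Set.ncard_univ]

end OrderType

section SelectionLabeling

variable {k : ℕ} {Θ : Set ((Fin k → ℕ) × (Fin k → ℕ))} {hΘ : Downward Θ}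
  {F : (Fin k → ℕ) → (r : ℕ) → (Fin r → (Fin k → ℕ) × ℕ) → Option ℕ}
  {D : Finset (Fin k → ℕ)} {x : Fin k → ℕ}

theorem sD_of_nonempty (h : (Phi Θ F D (sD Θ hΘ F D) x).Nonempty) :
    sD Θ hΘ F D x = sInf (Phi Θ F D (sD Θ hΘ F D) x) := by
  rw [sD]
  exact if_pos h

theorem sD_of_not_nonempty (h : ¬ (Phi Θ F D (sD Θ hΘ F D) x).Nonempty) :
    sD Θ hΘ F D x = vmin x := by
  rw [sD]
  exact if_neg h

theorem sDhat_of_nonempty (h : (Phi Θ F D (sD Θ hΘ F D) x).Nonempty) :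
    sDhat Θ hΘ F D x = sD Θ hΘ F D x :=
  if_pos h

theorem sDhat_of_not_nonempty (h : ¬ (Phi Θ F D (sD Θ hΘ F D) x).Nonempty) :
    sDhat Θ hΘ F D x = vmax x :=
  if_neg h

theorem exists_sD_eq_of_nonempty (hF : IsSelectionFamily Θ F)
    (h : (Phi Θ F D (sD Θ hΘ F D) x).Nonempty) :
    ∃ y ∈ D, (x, y) ∈ Θ ∧ sD Θ hΘ F D x = sD Θ hΘ F D y := by
  obtain ⟨r, -, y, hy, hFy⟩ := Nat.sInf_mem h
  obtain ⟨⟨i, hi⟩, -⟩ := hF _ _ _ _ hFy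
  exact ⟨y i, (hy i).1, (hy i).2, (sD_of_nonempty h).trans hi⟩

/-- Every selection label is the minimum of a vertex of no larger maximum. -/
theorem exists_sD_eq_vmin (hF : IsSelectionFamily Θ F) (hx : x ∈ D) :
    ∃ y ∈ D, vmax y ≤ vmax x ∧ sD Θ hΘ F D x = vmin y := by
  induction hn : vmax x using Nat.strong_induction_on generalizing x with
  | _ n ih =>
    subst hn
    by_cases h : (Phi Θ F D (sD Θ hΘ F D) x).Nonempty
    · obtain ⟨y, hy, hxy, heq⟩ := exists_sD_eq_of_nonempty hF h
      have hlt : vmax y < vmax x := hΘ _ hxy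
      obtain ⟨w, hw, hwy, hyw⟩ := ih _ hlt hy rfl
      exact ⟨w, hw, hwy.trans hlt.le, heq.trans hyw⟩
    · exact ⟨x, hx, le_rfl, sD_of_not_nonempty h⟩

theorem sD_lt_vmax_of_nonempty [NeZero k] (hF : IsSelectionFamily Θ F)
    (h : (Phi Θ F D (sD Θ hΘ F D) x).Nonempty) : sD Θ hΘ F D x < vmax x := by
  obtain ⟨y, hy, hxy, heq⟩ := exists_sD_eq_of_nonempty hF h
  obtain ⟨w, -, hwy, hyw⟩ := exists_sD_eq_vmin (hΘ := hΘ) hF hy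
  have hlt : vmax y < vmax x := hΘ _ hxy
  have hle := vmin_le_vmax w
  omega

theorem sDhat_le_vmax [NeZero k] (hF : IsSelectionFamily Θ F) :
    sDhat Θ hΘ F D x ≤ vmax x := by
  by_cases h : (Phi Θ F D (sD Θ hΘ F D) x).Nonempty
  · exact (sDhat_of_nonempty h).trans_le (sD_lt_vmax_of_nonempty hF h).le
  · exact (sDhat_of_not_nonempty h).le

theorem sDhat_lt_vmax_iff [NeZero k] (hF : IsSelectionFamily Θ F) :
    sDhat Θ hΘ F D x < vmax x ↔ (Phi Θ F D (sD Θ hΘ F D) x).Nonempty := by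
  refine ⟨fun hlt => ?_, fun h => ?_⟩
  · by_contra h
    exact hlt.ne (sDhat_of_not_nonempty h)
  · exact (sDhat_of_nonempty h).trans_lt (sD_lt_vmax_of_nonempty hF h)

/-- The relaxed labels determine the selection labels. -/
theorem sD_eq_of_sDhat_eq [NeZero k] (hF : IsSelectionFamily Θ F) {A B : Finset (Fin k → ℕ)}
    (h : sDhat Θ hΘ F A x = sDhat Θ hΘ F B x) : sD Θ hΘ F A x = sD Θ hΘ F B x := by
  by_cases hA : (Phi Θ F A (sD Θ hΘ F A) x).Nonempty
  · have hB : (Phi Θ F B (sD Θ hΘ F B) x).Nonempty := by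
      rwa [← sDhat_lt_vmax_iff hF, ← h, sDhat_lt_vmax_iff hF]
    rwa [sDhat_of_nonempty hA, sDhat_of_nonempty hB] at h
  · have hB : ¬ (Phi Θ F B (sD Θ hΘ F B) x).Nonempty := by
      rwa [← sDhat_lt_vmax_iff hF, ← h, sDhat_lt_vmax_iff hF]
    rw [sD_of_not_nonempty hA, sD_of_not_nonempty hB]

variable (Θ hΘ F) in
/-- The family of relaxed selection labelings, one for each finite domain. -/
def relaxedFamily : Set (Finset (Fin k → ℕ) × ((Fin k → ℕ) → ℕ)) :=
  Set.range fun D => (D, sDhat Θ hΘ F D)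

theorem fullFam_relaxedFamily : FullFam (relaxedFamily Θ hΘ F) :=
  fun D => ⟨_, D, rfl⟩

theorem reflexiveFam_relaxedFamily [NeZero k] (hF : IsSelectionFamily Θ F) :
    ReflexiveFam (relaxedFamily Θ hΘ F) := by
  rintro _ ⟨D, rfl⟩ x hx
  by_cases h : (Phi Θ F D (sD Θ hΘ F D) x).Nonempty
  · obtain ⟨y, hy, -, hxy⟩ := exists_sD_eq_vmin (hΘ := hΘ) hF hx
    obtain ⟨i, hi⟩ := exists_eq_vmin y
    exact ⟨y, hy, i, (sDhat_of_nonempty h).trans (hxy.trans hi)⟩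
  · obtain ⟨i, hi⟩ := exists_eq_vmax x
    exact ⟨x, hx, i, (sDhat_of_not_nonempty h).trans hi⟩

theorem jumpFreeFam_relaxedFamily [NeZero k] (hF : IsSelectionFamily Θ F) :
    JumpFreeFam (relaxedFamily Θ hΘ F) := by
  rintro _ ⟨A, rfl⟩ _ ⟨B, rfl⟩ x - - hAB heq
  dsimp only at hAB heq ⊢
  by_cases hA : (Phi Θ F A (sD Θ hΘ F A) x).Nonempty
  · have hsub : Phi Θ F A (sD Θ hΘ F A) x ⊆ Phi Θ F B (sD Θ hΘ F B) x := by
      rintro n ⟨r, hr, y, hy, hn⟩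
      have hlt : ∀ i, vmax (y i) < vmax x := fun i => hΘ _ (hy i).2
      refine ⟨r, hr, y, fun i => ⟨hAB _ (hy i).1 (hlt i), (hy i).2⟩, ?_⟩
      have hs : ∀ i, sD Θ hΘ F A (y i) = sD Θ hΘ F B (y i) := fun i =>
        sD_eq_of_sDhat_eq hF (heq _ (hy i).1 (hlt i))
      simpa only [hs] using hn
    have hB := hA.mono hsub
    rw [sDhat_of_nonempty hA, sDhat_of_nonempty hB, sD_of_nonempty hA, sD_of_nonempty hB]
    exact Nat.sInf_le (hsub (Nat.sInf_mem hA))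
  · exact (sDhat_le_vmax hF).trans_eq (sDhat_of_not_nonempty hA).symm

theorem RegressivelyRegular.sD_of_sDhat [NeZero k] (hF : IsSelectionFamily Θ F) {E : Finset ℕ}
    (h : RegressivelyRegular E (sDhat Θ hΘ F D)) : RegressivelyRegular E (sD Θ hΘ F D) := by
  intro x hx
  refine (h x hx).imp (fun hge y hy hxy => ?_) (fun hconst y hy z hz hxy hxz => ?_)
  · by_cases hne : (Phi Θ F D (sD Θ hΘ F D) y).Nonempty
    · exact (hge y hy hxy).trans_eq (sDhat_of_nonempty hne)
    · exact (sD_of_not_nonempty hne).ge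
  · have key : ∀ w ∈ cube k E, sDhat Θ hΘ F D w < sInf (E : Set ℕ) →
        sDhat Θ hΘ F D w = sD Θ hΘ F D w := fun w hw hlt => by
      refine sDhat_of_nonempty ((sDhat_lt_vmax_iff hF).1 (hlt.trans_le ?_))
      have hw0 : w 0 ∈ (E : Set ℕ) := Fintype.mem_piFinset.1 hw 0
      exact (Nat.sInf_le hw0).trans (le_vmax w 0)
    obtain ⟨heq, hlty⟩ := hconst y hy z hz hxy hxz
    rw [← key y hy hlty, ← key z hz (heq ▸ hlty)]
    exact ⟨heq, hlty⟩

end SelectionLabeling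

/-- Multiverse HF (Theorem 3.5): the case of Multiverse SL in which
`Θ = {(x, y) : max x > max y}` is the maximal downward edge set. -/
theorem multiverse_HF {k : ℕ} (hk : 2 ≤ k) (hJF : JumpFreeTheorem k)
    (F : (Fin k → ℕ) → (r : ℕ) → (Fin r → (Fin k → ℕ) × ℕ) → Option ℕ)
    (hF : IsSelectionFamily (maxTheta k) F)
    (p : ℕ) (hp : 0 < p) :
    ∃ (D : Finset (Fin k → ℕ)) (E : Finset ℕ),
      E.card = p ∧ cube k E ⊆ D ∧
      RegressivelyRegular E (sD (maxTheta k) (maxTheta_downward k) F D) ∧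
      (sigLabels (sD (maxTheta k) (maxTheta_downward k) F D)
        (cube k E : Set (Fin k → ℕ))).ncard ≤ k ^ k := by
  have : NeZero k := ⟨by omega⟩
  obtain ⟨D, E, f, ⟨D', hD'⟩, hE, hcube, hreg⟩ :=
    hJF (relaxedFamily _ (maxTheta_downward k) F) fullFam_relaxedFamily
      (reflexiveFam_relaxedFamily hF) (jumpFreeFam_relaxedFamily hF) p hp
  obtain ⟨rfl, rfl⟩ := Prod.mk.inj hD'
  have hs := hreg.sD_of_sDhat hF
  exact ⟨D', E, hE, hcube, hs, hs.ncard_sigLabels_le⟩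

end LatticeMultiverse
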